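/- Let $\rho, \mu$ be probability measures on compact sets $\mathcal{X}, \mathcal{Y} \subset \mathbb{R}^d$, and let $c \in C^1(\mathcal{X} \times \mathcal{Y})$. Assume $\mathrm{supp}\,\rho = \bigcup_{i \in I} A_i$ and $\mathrm{supp}\,\mu = \bigcup_{j \in J} B_j$ are finite unions of Lipschitz-path connected components. Define the bipartite graph $G$ with vertices $(A_i)_{i\in I} \cup (B_j)_{j \in J}$ and an edge $(A_i, B_j)$ iff some optimal plan $\gamma \in \Pi(\rho,\mu)$ satisfies $\gamma(A_i \times B_j) > 0$. If $G$ is connected, then optimal dual potentials for the problem $\sup \{\int \phi\, d\rho + \int \psi\, d\mu : \phi(x) + \psi(y) \leq c(x,y)\}$ are unique up to an additive constant ($\phi \mapsto \phi + \lambda$, $\psi \mapsto \psi - \lambda$). -/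

import Mathlib

open MeasureTheory

/-- The topological support of a measure: points all of whose open neighbourhoods
have positive measure. -/
def msupport {α : Type*} [TopologicalSpace α] [MeasurableSpace α] (μ : Measure α) : Set α :=
  {x | ∀ U : Set α, IsOpen U → x ∈ U → μ U ≠ 0}

/-- A set is Lipschitz-path connected if any two of its points are joined by a Lipschitz
curve valued in the set. -/
def LipPathConn {d : ℕ} (S : Set (EuclideanSpace ℝ (Fin d))) : Prop :=
  ∀ x₀ ∈ S, ∀ x₁ ∈ S, ∃ (ω : ℝ → EuclideanSpace ℝ (Fin d)) (L : NNReal),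
    LipschitzWith L ω ∧ ω 0 = x₀ ∧ ω 1 = x₁ ∧ ∀ t ∈ Set.Icc (0 : ℝ) 1, ω t ∈ S

/-- An optimal plan between `ρ` and `μ` for the cost `c`. -/
def IsOptimalPlan {d : ℕ} (ρ μ : Measure (EuclideanSpace ℝ (Fin d)))
    (c : EuclideanSpace ℝ (Fin d) → EuclideanSpace ℝ (Fin d) → ℝ)
    (γ : Measure (EuclideanSpace ℝ (Fin d) × EuclideanSpace ℝ (Fin d))) : Prop :=
  γ.fst = ρ ∧ γ.snd = μ ∧
    ∀ γ' : Measure (EuclideanSpace ℝ (Fin d) × EuclideanSpace ℝ (Fin d)),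
      γ'.fst = ρ → γ'.snd = μ → ∫ q, c q.1 q.2 ∂γ ≤ ∫ q, c q.1 q.2 ∂γ'

/-- The relation generating the bipartite graph on the Lipschitz-path connected components
`(Aᵢ)` of `supp ρ` and `(Bⱼ)` of `supp μ`: an edge iff some optimal plan gives positive
mass to `Aᵢ × Bⱼ`. -/
def componentRel {d : ℕ} {I J : Type} (ρ μ : Measure (EuclideanSpace ℝ (Fin d)))
    (c : EuclideanSpace ℝ (Fin d) → EuclideanSpace ℝ (Fin d) → ℝ)
    (A : I → Set (EuclideanSpace ℝ (Fin d))) (B : J → Set (EuclideanSpace ℝ (Fin d))) :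
    (I ⊕ J) → (I ⊕ J) → Prop
  | Sum.inl i, Sum.inr j => ∃ γ, IsOptimalPlan ρ μ c γ ∧ 0 < γ (A i ×ˢ B j)
  | _, _ => False

open Filter Topology Set

theorem exists_linear_le_sublinear_eq {E : Type*} [AddCommGroup E] [Module ℝ E] (N : E → ℝ)
    (N_hom : ∀ c : ℝ, 0 < c → ∀ x, N (c • x) = c * N x)
    (N_add : ∀ x y, N (x + y) ≤ N x + N y) (x : E) :
    ∃ g : E →ₗ[ℝ] ℝ, g x = N x ∧ ∀ y, g y ≤ N y := by
  have N_zero : N 0 = 0 := by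
    have h := N_hom 2 (by norm_num) 0
    rw [smul_zero] at h
    linarith
  have hwd : ∀ t : ℝ, t • x = 0 → t • N x = 0 := by
    intro t ht
    rcases smul_eq_zero.1 ht with h | h
    · simp [h]
    · simp [h, N_zero]
  obtain ⟨g, hg, hgN⟩ := exists_extension_of_le_sublinear
    (LinearPMap.mkSpanSingleton' x (N x) hwd) N N_hom N_add (by
      rintro ⟨y, hy⟩
      obtain ⟨t, rfl⟩ := Submodule.mem_span_singleton.1 hy
      rw [LinearPMap.mkSpanSingleton'_apply, smul_eq_mul]
      rcases lt_trichotomy t 0 with ht | rfl | ht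
      · have h₁ := N_add (t • x) ((-t) • x)
        rw [← add_smul, add_neg_cancel, zero_smul, N_zero, N_hom (-t) (by linarith)] at h₁
        change t * N x ≤ N (t • x)
        linarith
      · simp [N_zero]
      · exact (N_hom t ht x).ge)
  refine ⟨g, ?_, hgN⟩
  have hx : x ∈ Submodule.span ℝ {x} := Submodule.mem_span_singleton_self x
  have h := hg ⟨x, hx⟩
  exact h.trans (LinearPMap.mkSpanSingleton'_apply_self x (N x) hwd hx)

/-- A positive linear functional on `C(K, ℝ)`, `K` compact, is integration against a finite
measure. -/
theorem exists_measure_of_nonneg_functional {K : Type*} [TopologicalSpace K] [T2Space K]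
    [CompactSpace K] [MeasurableSpace K] [BorelSpace K] (g : C(K, ℝ) →ₗ[ℝ] ℝ)
    (hg : ∀ h : C(K, ℝ), 0 ≤ h → 0 ≤ g h) :
    ∃ π : Measure K, IsFiniteMeasure π ∧ ∀ h : C(K, ℝ), ∫ k, h k ∂π = g h := by
  let Λ : CompactlySupportedContinuousMap K ℝ →ₚ[ℝ] ℝ := PositiveLinearMap.mk₀
    { toFun := fun h => g h.toContinuousMap
      map_add' := fun h k => g.map_add h.toContinuousMap k.toContinuousMap
      map_smul' := fun r h => g.map_smul r h.toContinuousMap } fun h hh => hg _ hh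
  refine ⟨RealRMK.rieszMeasure Λ, inferInstance, fun h => ?_⟩
  exact RealRMK.integral_rieszMeasure Λ (CompactlySupportedContinuousMap.continuousMapEquiv h)

section Duality

variable {X Y : Type*} [MetricSpace X] [MeasurableSpace X] [MetricSpace Y] [MeasurableSpace Y]

/-- The values `∫ φ dρ + ∫ ψ dμ` of continuous pairs with `φ ⊕ ψ ≥ h`. -/
def superValues (ρ : Measure X) (μ : Measure Y) (h : C(X × Y, ℝ)) : Set ℝ :=
  {r | ∃ (φ : C(X, ℝ)) (ψ : C(Y, ℝ)), (∀ x y, h (x, y) ≤ φ x + ψ y) ∧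
    r = ∫ x, φ x ∂ρ + ∫ y, ψ y ∂μ}

variable {ρ : Measure X} {μ : Measure Y}

theorem smul_mem_superValues {h : C(X × Y, ℝ)} {t r : ℝ} (ht : 0 ≤ t)
    (hr : r ∈ superValues ρ μ h) : t * r ∈ superValues ρ μ (t • h) := by
  obtain ⟨φ, ψ, hφψ, rfl⟩ := hr
  refine ⟨t • φ, t • ψ, fun x y => ?_, ?_⟩
  · have := mul_le_mul_of_nonneg_left (hφψ x y) ht
    simpa [mul_add] using this
  · simp [integral_const_mul, mul_add]

variable [CompactSpace X] [CompactSpace Y]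

theorem superValues_nonempty (h : C(X × Y, ℝ)) : (superValues ρ μ h).Nonempty :=
  ⟨_, ContinuousMap.const X ‖h‖, 0, fun x y => by
    simpa using le_of_abs_le (h.norm_coe_le_norm (x, y)), rfl⟩

variable [BorelSpace X] [BorelSpace Y] [IsProbabilityMeasure ρ] [IsProbabilityMeasure μ]

theorem le_of_mem_superValues {h : C(X × Y, ℝ)} {b r : ℝ} (hb : ∀ q, b ≤ h q)
    (hr : r ∈ superValues ρ μ h) : b ≤ r := by
  obtain ⟨φ, ψ, hφψ, rfl⟩ := hr
  have hφ : Integrable φ ρ := φ.continuous.integrable_of_hasCompactSupport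
    (HasCompactSupport.of_compactSpace φ)
  have hψ : Integrable ψ μ := ψ.continuous.integrable_of_hasCompactSupport
    (HasCompactSupport.of_compactSpace ψ)
  have h₁ : ∀ y, b - ψ y ≤ ∫ x, φ x ∂ρ := fun y => by
    have := integral_mono (μ := ρ) (integrable_const (b - ψ y)) hφ
      (fun x => by linarith [hb (x, y), hφψ x y])
    simpa using this
  have h₂ := integral_mono (μ := μ) (integrable_const (b - ∫ x, φ x ∂ρ)) hψ
      (fun y => by linarith [h₁ y])
  simp only [integral_const, probReal_univ, one_smul] at h₂
  linarith

theorem bddBelow_superValues (h : C(X × Y, ℝ)) : BddBelow (superValues ρ μ h) :=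
  ⟨-‖h‖, fun _ hr => le_of_mem_superValues
    (fun q => neg_le_of_abs_le (h.norm_coe_le_norm q)) hr⟩

theorem add_mem_superValues {h k : C(X × Y, ℝ)} {r s : ℝ} (hr : r ∈ superValues ρ μ h)
    (hs : s ∈ superValues ρ μ k) : r + s ∈ superValues ρ μ (h + k) := by
  obtain ⟨φ, ψ, hφψ, rfl⟩ := hr
  obtain ⟨φ', ψ', hφψ', rfl⟩ := hs
  have hi : ∀ f : C(X, ℝ), Integrable f ρ := fun f =>
    f.continuous.integrable_of_hasCompactSupport (HasCompactSupport.of_compactSpace f)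
  have hi' : ∀ f : C(Y, ℝ), Integrable f μ := fun f =>
    f.continuous.integrable_of_hasCompactSupport (HasCompactSupport.of_compactSpace f)
  refine ⟨φ + φ', ψ + ψ', fun x y => ?_, ?_⟩
  · simp only [ContinuousMap.add_apply]
    linarith [hφψ x y, hφψ' x y]
  · simp only [ContinuousMap.add_apply]
    rw [integral_add (hi φ) (hi φ'), integral_add (hi' ψ) (hi' ψ')]
    ring

theorem sInf_superValues_smul_le (h : C(X × Y, ℝ)) {t : ℝ} (ht : 0 < t) :
    sInf (superValues ρ μ (t • h)) ≤ t * sInf (superValues ρ μ h) := by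
  rw [← div_le_iff₀' ht]
  refine le_csInf (superValues_nonempty h) fun r hr => ?_
  rw [div_le_iff₀' ht]
  exact csInf_le (bddBelow_superValues _) (smul_mem_superValues ht.le hr)

theorem sInf_superValues_smul (h : C(X × Y, ℝ)) {t : ℝ} (ht : 0 < t) :
    sInf (superValues ρ μ (t • h)) = t * sInf (superValues ρ μ h) := by
  refine le_antisymm (sInf_superValues_smul_le h ht) ?_
  have := sInf_superValues_smul_le (ρ := ρ) (μ := μ) (t • h) (inv_pos.2 ht)
  rwa [smul_smul, inv_mul_cancel₀ ht.ne', one_smul, ← div_eq_inv_mul, le_div_iff₀' ht] at this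

theorem sInf_superValues_add_le (h k : C(X × Y, ℝ)) :
    sInf (superValues ρ μ (h + k)) ≤ sInf (superValues ρ μ h) + sInf (superValues ρ μ k) := by
  rw [← sub_le_iff_le_add]
  refine le_csInf (superValues_nonempty h) fun r hr => ?_
  rw [sub_le_comm]
  refine le_csInf (superValues_nonempty k) fun s hs => ?_
  have := csInf_le (bddBelow_superValues _) (add_mem_superValues hr hs)
  linarith

/-- **Kantorovich duality** on compact metric spaces: some plan has cost at most any upper bound
of the dual values of continuous admissible pairs. -/
theorem exists_plan_integral_le_dual [SecondCountableTopology X] [SecondCountableTopology Y]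
    (c : C(X × Y, ℝ)) :
    ∃ π : Measure (X × Y), π.fst = ρ ∧ π.snd = μ ∧ ∀ M : ℝ,
      (∀ (φ : C(X, ℝ)) (ψ : C(Y, ℝ)), (∀ x y, φ x + ψ y ≤ c (x, y)) →
        ∫ x, φ x ∂ρ + ∫ y, ψ y ∂μ ≤ M) → ∫ q, c q ∂π ≤ M := by
  obtain ⟨g, hgc, hg⟩ := exists_linear_le_sublinear_eq (fun h => sInf (superValues ρ μ h))
    (fun t ht h => sInf_superValues_smul h ht) sInf_superValues_add_le (-c)
  have hg_le : ∀ (h : C(X × Y, ℝ)) (φ : C(X, ℝ)) (ψ : C(Y, ℝ)),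
      (∀ x y, h (x, y) ≤ φ x + ψ y) → g h ≤ ∫ x, φ x ∂ρ + ∫ y, ψ y ∂μ :=
    fun h φ ψ hh => (hg h).trans (csInf_le (bddBelow_superValues _) ⟨φ, ψ, hh, rfl⟩)
  obtain ⟨π, hπ, hπg⟩ := exists_measure_of_nonneg_functional g fun h hh => by
    have := hg_le (-h) 0 0 fun x y => by simpa using hh (x, y)
    simpa using this
  refine ⟨π, ?_, ?_, fun M hM => ?_⟩
  · refine ext_of_forall_integral_eq_of_IsFiniteMeasure fun f => ?_
    have h₁ := hg_le (f.toContinuousMap.comp ContinuousMap.fst) f.toContinuousMap 0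
      fun x y => by simp
    have h₂ := hg_le (-f.toContinuousMap.comp ContinuousMap.fst) (-f.toContinuousMap) 0
      fun x y => by simp
    rw [← hπg] at h₁ h₂
    simp only [ContinuousMap.neg_apply, integral_neg, ContinuousMap.zero_apply,
      integral_zero, add_zero, neg_le_neg_iff] at h₁ h₂
    rw [Measure.fst, integral_map measurable_fst.aemeasurable
      f.continuous.aestronglyMeasurable]
    exact le_antisymm h₁ h₂
  · refine ext_of_forall_integral_eq_of_IsFiniteMeasure fun f => ?_
    have h₁ := hg_le (f.toContinuousMap.comp ContinuousMap.snd) 0 f.toContinuousMap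
      fun x y => by simp
    have h₂ := hg_le (-f.toContinuousMap.comp ContinuousMap.snd) 0 (-f.toContinuousMap)
      fun x y => by simp
    rw [← hπg] at h₁ h₂
    simp only [ContinuousMap.neg_apply, integral_neg, ContinuousMap.zero_apply,
      integral_zero, zero_add, neg_le_neg_iff] at h₁ h₂
    rw [Measure.snd, integral_map measurable_snd.aemeasurable
      f.continuous.aestronglyMeasurable]
    exact le_antisymm h₁ h₂
  · have h : -M ≤ sInf (superValues ρ μ (-c)) := by
      refine le_csInf (superValues_nonempty _) ?_
      rintro _ ⟨φ, ψ, hφψ, rfl⟩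
      have := hM (-φ) (-ψ) fun x y => by
        have := hφψ x y
        simp only [ContinuousMap.neg_apply] at this ⊢
        linarith
      simp only [ContinuousMap.neg_apply, integral_neg] at this
      linarith
    rw [hπg]
    rw [← hgc, map_neg] at h
    linarith

end Duality

theorem exists_local_slope_bound {E : Type*} [NormedAddCommGroup E] [NormedSpace ℝ E]
    {F : E → ℝ} {K : Set E} (hK : IsCompact K) (hF : ContDiffOn ℝ 1 F K) :
    ∃ M : ℝ, 0 ≤ M ∧ ∀ q ∈ K, ∀ᶠ q' in 𝓝[K] q, |F q' - F q| ≤ M * ‖q' - q‖ := by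
  refine hK.induction_on (p := fun T => ∃ M : ℝ, 0 ≤ M ∧
    ∀ q ∈ T, ∀ᶠ q' in 𝓝[K] q, |F q' - F q| ≤ M * ‖q' - q‖) ⟨0, le_rfl, by simp⟩ ?_ ?_ ?_
  · rintro s t hst ⟨M, hM₀, hM⟩
    exact ⟨M, hM₀, fun q hq => hM q (hst hq)⟩
  · rintro s t ⟨M, hM₀, hM⟩ ⟨M', hM₀', hM'⟩
    refine ⟨max M M', hM₀.trans (le_max_left _ _), ?_⟩
    rintro q (hq | hq)
    · filter_upwards [hM q hq] with q' h
      exact h.trans (mul_le_mul_of_nonneg_right (le_max_left _ _) (norm_nonneg _))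
    · filter_upwards [hM' q hq] with q' h
      exact h.trans (mul_le_mul_of_nonneg_right (le_max_right _ _) (norm_nonneg _))
  · intro x hx
    have hFx : ContDiffWithinAt ℝ (0 + 1) F K x := by simpa using hF x hx
    obtain ⟨u, hu, -, -, f', hf', hcont⟩ :=
      (contDiffWithinAt_succ_iff_hasFDerivWithinAt' (by simp)).1 hFx
    rw [insert_eq_of_mem hx] at hu
    have hb : ∀ᶠ q in 𝓝[K] x, ‖f' q‖ < ‖f' x‖ + 1 :=
      hcont.continuousWithinAt.norm.eventually_lt_const (lt_add_one _)
    refine ⟨u ∩ {q | ‖f' q‖ < ‖f' x‖ + 1}, inter_mem hu hb, ‖f' x‖ + 1 + 1, by positivity, ?_⟩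
    rintro q ⟨hqu, hq⟩
    filter_upwards [(hf' q hqu).isLittleO.def one_pos] with q' hq'
    rw [one_mul] at hq'
    calc |F q' - F q| = ‖(F q' - F q - f' q (q' - q)) + f' q (q' - q)‖ := by
          rw [sub_add_cancel, Real.norm_eq_abs]
      _ ≤ ‖q' - q‖ + (‖f' x‖ + 1) * ‖q' - q‖ :=
          (norm_add_le _ _).trans (add_le_add hq' ((f' q).le_of_opNorm_le hq.le _))
      _ = (‖f' x‖ + 1 + 1) * ‖q' - q‖ := by ring

theorem sub_le_of_local_slope_bound {u : ℝ → ℝ} {C a b : ℝ} (hab : a ≤ b)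
    (hu : ContinuousOn u (Icc a b))
    (h : ∀ z ∈ Icc a b, ∀ᶠ w in 𝓝[Icc a b] z, u w - u z ≤ C * |w - z|) :
    u b - u a ≤ C * (b - a) := by
  have key := image_le_of_liminf_slope_right_le_deriv_boundary (f := u)
    (B := fun z => u a + C * (z - a)) (B' := fun _ => C) hu (by simp) (by fun_prop)
    (fun x _ => by
      simpa using ((((hasDerivAt_id x).sub_const a).const_mul C).const_add (u a)).hasDerivWithinAt)
    (fun x hx r hr => by
      have h' : ∀ᶠ w in 𝓝[>] x, u w - u x ≤ C * |w - x| := by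
        have := (h x ⟨hx.1, hx.2.le⟩).filter_mono (nhdsWithin_mono x
          (Ioc_subset_Icc_self.trans (Icc_subset_Icc_left hx.1)))
        rwa [nhdsWithin_Ioc_eq_nhdsGT hx.2] at this
      refine Eventually.frequently ?_
      filter_upwards [h', self_mem_nhdsWithin] with w hw hxw
      have hpos : 0 < w - x := sub_pos.2 hxw
      rw [abs_of_pos hpos] at hw
      rw [slope_def_field]
      exact ((div_le_iff₀ hpos).2 hw).trans_lt hr)
    (right_mem_Icc.2 hab)
  linarith

theorem abs_sub_le_of_local_slope_bound {u : ℝ → ℝ} {C a b : ℝ}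
    (hu : ContinuousOn u (Icc a b))
    (h : ∀ z ∈ Icc a b, ∀ᶠ w in 𝓝[Icc a b] z, |u w - u z| ≤ C * |w - z|)
    {s t : ℝ} (hs : s ∈ Icc a b) (ht : t ∈ Icc a b) :
    |u s - u t| ≤ C * |s - t| := by
  wlog hst : t ≤ s generalizing s t
  · rw [abs_sub_comm, abs_sub_comm s]
    exact this ht hs (le_of_not_ge hst)
  have hsub : Icc t s ⊆ Icc a b := Icc_subset_Icc ht.1 hs.2
  have h' : ∀ z ∈ Icc t s, ∀ᶠ w in 𝓝[Icc t s] z, |u w - u z| ≤ C * |w - z| :=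
    fun z hz => (h z (hsub hz)).filter_mono (nhdsWithin_mono z hsub)
  have h₁ := sub_le_of_local_slope_bound hst (hu.mono hsub) fun z hz =>
    (h' z hz).mono fun w hw => (le_abs_self _).trans hw
  have h₂ := sub_le_of_local_slope_bound (u := fun z => -u z) hst (hu.mono hsub).neg
    fun z hz => (h' z hz).mono fun w hw => (le_of_eq (by ring)).trans ((neg_le_abs _).trans hw)
  rw [abs_of_nonneg (sub_nonneg.2 hst)]
  exact abs_le.2 ⟨by linarith, h₁⟩

theorem lipschitzOnWith_potential_along_path {E F : Type*} {X : Set E} {Y : Set F}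
    {c : E → F → ℝ} {ω : ℝ → E} {T : Set ℝ} {C : NNReal}
    (hωX : ∀ t ∈ T, ω t ∈ X)
    (hC : ∀ y ∈ Y, ∀ s ∈ T, ∀ t ∈ T, |c (ω s) y - c (ω t) y| ≤ C * |s - t|)
    {φ : E → ℝ} {ψ : F → ℝ} (hadm : ∀ x ∈ X, ∀ y ∈ Y, φ x + ψ y ≤ c x y)
    (hsat : ∀ t ∈ T, ∃ y ∈ Y, φ (ω t) + ψ y = c (ω t) y) :
    LipschitzOnWith C (fun t => φ (ω t)) T := by
  refine LipschitzOnWith.of_le_add_mul C fun s hs t ht => ?_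
  obtain ⟨y, hy, heq⟩ := hsat t ht
  have h₁ := hadm _ (hωX s hs) y hy
  have h₂ := (le_abs_self _).trans (hC y hy s hs t ht)
  rw [Real.dist_eq]
  linarith

section Path

variable {E F : Type*} [NormedAddCommGroup E] [NormedSpace ℝ E]
  [NormedAddCommGroup F] [NormedSpace ℝ F] {X : Set E} {Y : Set F} {c : E → F → ℝ}

/-- Along a Lipschitz curve in `X`, a `C¹` cost is Lipschitz uniformly in the second variable. -/
theorem exists_lipschitz_cost_along_path (hX : IsCompact X) (hY : IsCompact Y)
    (hc : ContDiffOn ℝ 1 (fun q : E × F => c q.1 q.2) (X ×ˢ Y)) {ω : ℝ → E} {L : NNReal}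
    (hω : LipschitzWith L ω) {a b : ℝ} (hωX : ∀ t ∈ Icc a b, ω t ∈ X) :
    ∃ C : NNReal, ∀ y ∈ Y, ∀ s ∈ Icc a b, ∀ t ∈ Icc a b,
      |c (ω s) y - c (ω t) y| ≤ C * |s - t| := by
  obtain ⟨M, hM₀, hM⟩ := exists_local_slope_bound (hX.prod hY) hc
  refine ⟨⟨M * L, by positivity⟩, fun y hy s hs t ht => ?_⟩
  have hmaps : MapsTo (fun z => (ω z, y)) (Icc a b) (X ×ˢ Y) := fun z hz => ⟨hωX z hz, hy⟩
  have hcont : Continuous fun z => (ω z, y) := hω.continuous.prodMk continuous_const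
  refine abs_sub_le_of_local_slope_bound (u := fun z => c (ω z) y)
    (hc.continuousOn.comp hcont.continuousOn hmaps) (fun z hz => ?_) hs ht
  have htend : Tendsto (fun z => (ω z, y)) (𝓝[Icc a b] z) (𝓝[X ×ˢ Y] (ω z, y)) :=
    hcont.continuousWithinAt.tendsto_nhdsWithin hmaps
  filter_upwards [htend.eventually (hM _ (hmaps hz))] with w hw
  refine hw.trans ?_
  have hL : ‖ω w - ω z‖ ≤ L * |w - z| := by
    simpa [dist_eq_norm] using hω.dist_le_mul w z
  have : ‖(ω w, y) - (ω z, y)‖ = ‖ω w - ω z‖ := by simp [Prod.norm_def]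
  rw [this]
  change M * _ ≤ M * L * |w - z|
  rw [mul_assoc]
  exact mul_le_mul_of_nonneg_left hL hM₀

/-- Two potentials saturated at a common point over every point of a Lipschitz curve have
the same increment along it. -/
theorem potential_sub_eq_of_path [FiniteDimensional ℝ E] (hX : IsCompact X) (hY : IsCompact Y)
    (hc : ContDiffOn ℝ 1 (fun q : E × F => c q.1 q.2) (X ×ˢ Y))
    {φ₀ φ₁ : E → ℝ} {ψ₀ ψ₁ : F → ℝ}
    (hadm₀ : ∀ x ∈ X, ∀ y ∈ Y, φ₀ x + ψ₀ y ≤ c x y)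
    (hadm₁ : ∀ x ∈ X, ∀ y ∈ Y, φ₁ x + ψ₁ y ≤ c x y)
    {ω : ℝ → E} {L : NNReal} (hω : LipschitzWith L ω) (hωX : ∀ t ∈ Icc (0 : ℝ) 1, ω t ∈ X)
    (hsat : ∀ t ∈ Icc (0 : ℝ) 1, ∃ y ∈ Y, φ₀ (ω t) + ψ₀ y = c (ω t) y ∧
      φ₁ (ω t) + ψ₁ y = c (ω t) y) :
    φ₁ (ω 0) - φ₀ (ω 0) = φ₁ (ω 1) - φ₀ (ω 1) := by
  obtain ⟨C, hC⟩ := exists_lipschitz_cost_along_path hX hY hc hω hωX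
  have hLip₀ := lipschitzOnWith_potential_along_path hωX hC hadm₀ fun t ht =>
    let ⟨y, hy, h, _⟩ := hsat t ht; ⟨y, hy, h⟩
  have hLip₁ := lipschitzOnWith_potential_along_path hωX hC hadm₁ fun t ht =>
    let ⟨y, hy, _, h⟩ := hsat t ht; ⟨y, hy, h⟩
  rw [← uIcc_of_le zero_le_one] at hLip₀ hLip₁
  have hac₀ := hLip₀.absolutelyContinuousOnInterval
  have hac₁ := hLip₁.absolutelyContinuousOnInterval
  obtain ⟨k, hk⟩ := (hac₁.sub hac₀).const_of_ae_hasDerivAt_zero (by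
    have hends : ∀ᵐ t : ℝ, t ≠ 0 ∧ t ≠ 1 :=
      (Measure.ae_ne volume 0).and (Measure.ae_ne volume 1)
    filter_upwards [hac₀.ae_differentiableAt, hac₁.ae_differentiableAt,
      hω.ae_differentiableAt_real, hends] with t ht₀ ht₁ htω hne ht
    have hd₀ := ht₀ ht
    have hd₁ := ht₁ ht
    rw [uIcc_of_le zero_le_one] at ht
    have hnhds : Icc (0 : ℝ) 1 ∈ 𝓝 t :=
      Icc_mem_nhds (ht.1.lt_of_ne' hne.1) (ht.2.lt_of_ne hne.2)
    obtain ⟨y, hy, heq₀, heq₁⟩ := hsat t ht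
    have hdc : DifferentiableAt ℝ (fun s => c (ω s) y) t := by
      have h₁ := (hc.differentiableOn one_ne_zero) (ω t, y)
        (mk_mem_prod (hωX t ht) hy)
      have h₂ : DifferentiableWithinAt ℝ (fun s => (ω s, y)) (Icc 0 1) t :=
        (htω.prodMk (differentiableAt_const y)).differentiableWithinAt
      exact (h₁.comp t h₂ fun s hs => mk_mem_prod (hωX s hs) hy).differentiableAt hnhds
    have hderiv : ∀ (φ : E → ℝ) (ψ : F → ℝ), (∀ x ∈ X, ∀ y ∈ Y, φ x + ψ y ≤ c x y) →
        φ (ω t) + ψ y = c (ω t) y → DifferentiableAt ℝ (fun s => φ (ω s)) t →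
        deriv (fun s => φ (ω s)) t = deriv (fun s => c (ω s) y) t := by
      intro φ ψ hadm heq hd
      have hmax : IsLocalMax (fun s => φ (ω s) - c (ω s) y) t := by
        filter_upwards [hnhds] with s hs
        have := hadm _ (hωX s hs) y hy
        linarith
      have hzero := hmax.deriv_eq_zero
      rw [deriv_fun_sub hd hdc] at hzero
      linarith
    have h := hd₁.hasDerivAt.sub hd₀.hasDerivAt
    rwa [hderiv φ₁ ψ₁ hadm₁ heq₁ hd₁, hderiv φ₀ ψ₀ hadm₀ heq₀ hd₀, sub_self] at h)
  exact (hk 0 (by simp)).trans (hk 1 (by simp)).symm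

end Path

theorem exists_const_potential_sub {d : ℕ} {X Y S : Set (EuclideanSpace ℝ (Fin d))}
    (hX : IsCompact X) (hY : IsCompact Y)
    {c : EuclideanSpace ℝ (Fin d) → EuclideanSpace ℝ (Fin d) → ℝ}
    (hc : ContDiffOn ℝ 1 (fun q : EuclideanSpace ℝ (Fin d) × EuclideanSpace ℝ (Fin d) =>
      c q.1 q.2) (X ×ˢ Y))
    {φ₀ ψ₀ φ₁ ψ₁ : EuclideanSpace ℝ (Fin d) → ℝ}
    (hadm₀ : ∀ x ∈ X, ∀ y ∈ Y, φ₀ x + ψ₀ y ≤ c x y)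
    (hadm₁ : ∀ x ∈ X, ∀ y ∈ Y, φ₁ x + ψ₁ y ≤ c x y)
    (hSX : S ⊆ X) (hS : LipPathConn S)
    (hsat : ∀ x ∈ S, ∃ y ∈ Y, φ₀ x + ψ₀ y = c x y ∧ φ₁ x + ψ₁ y = c x y) :
    ∃ a : ℝ, ∀ x ∈ S, φ₁ x - φ₀ x = a := by
  rcases S.eq_empty_or_nonempty with rfl | ⟨x₀, hx₀⟩
  · exact ⟨0, by simp⟩
  refine ⟨φ₁ x₀ - φ₀ x₀, fun x hx => ?_⟩
  obtain ⟨ω, L, hω, rfl, rfl, hωS⟩ := hS x hx x₀ hx₀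
  exact potential_sub_eq_of_path hX hY hc hadm₀ hadm₁ hω (fun t ht => hSX (hωS t ht))
    fun t ht => hsat _ (hωS t ht)

section Support

variable {E : Type*} [TopologicalSpace E] [MeasurableSpace E]

theorem msupport_eq_support (ν : Measure E) : msupport ν = ν.support := by
  rw [Measure.support_eq_forall_isOpen]
  ext x
  simp only [msupport, mem_ofPred_eq, pos_iff_ne_zero]
  exact ⟨fun h U hx hU => h U hU hx, fun h U hU hx => h U hx hU⟩

theorem measure_compl_of_msupport_subset [HereditarilyLindelofSpace E] {ν : Measure E}
    {S : Set E} (hS : msupport ν ⊆ S) : ν Sᶜ = 0 := by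
  rw [msupport_eq_support] at hS
  exact measure_mono_null (compl_subset_compl.2 hS) Measure.measure_compl_support

end Support

section Plans

variable {E F : Type*} [MeasurableSpace E] [MeasurableSpace F]

theorem measure_compl_prod_of_marginals {ρ : Measure E} {μ : Measure F} {γ : Measure (E × F)}
    (hfst : γ.fst = ρ) (hsnd : γ.snd = μ) {X : Set E} {Y : Set F} (hX : MeasurableSet X)
    (hY : MeasurableSet Y) (hρ : ρ Xᶜ = 0) (hμ : μ Yᶜ = 0) : γ (X ×ˢ Y)ᶜ = 0 := by
  rw [compl_prod_eq_union, measure_union_null_iff, prod_univ, univ_prod,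
    ← Measure.fst_apply hX.compl, ← Measure.snd_apply hY.compl, hfst, hsnd]
  exact ⟨hρ, hμ⟩

theorem map_comap_coe_of_measure_compl {ρ : Measure E} {X : Set E} (hX : MeasurableSet X)
    (hρ : ρ Xᶜ = 0) : (ρ.comap ((↑) : X → E)).map (↑) = ρ := by
  rw [map_comap_subtype_coe hX]
  exact Measure.restrict_eq_self_of_ae_mem hρ

theorem isProbabilityMeasure_comap_coe {ρ : Measure E} [IsProbabilityMeasure ρ] {X : Set E}
    (hX : MeasurableSet X) (hρ : ρ Xᶜ = 0) :
    IsProbabilityMeasure (ρ.comap ((↑) : X → E)) := by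
  constructor
  rw [comap_subtype_coe_apply hX, image_univ, Subtype.range_coe]
  exact (prob_compl_eq_zero_iff hX).1 hρ

variable [TopologicalSpace E] [OpensMeasurableSpace E]

theorem integrable_of_continuousOn_of_measure_compl [T2Space E]
    {ν : Measure E} [IsFiniteMeasure ν] {K : Set E} (hK : IsCompact K) (hν : ν Kᶜ = 0)
    {f : E → ℝ} (hf : ContinuousOn f K) : Integrable f ν := by
  rw [← Measure.restrict_eq_self_of_ae_mem (s := K) hν]
  exact hf.integrableOn_compact hK

/-- A continuous function on a compact set carrying `ρ`, extended by zero. -/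
theorem integrable_extend_and_integral_eq [T2Space E] {ρ : Measure E} [IsProbabilityMeasure ρ]
    {X : Set E} (hX : IsCompact X) (hρ : ρ Xᶜ = 0) (φ : C(X, ℝ)) :
    Integrable (Function.extend Subtype.val φ 0) ρ ∧
      ∫ x, Function.extend Subtype.val φ 0 x ∂ρ = ∫ x, φ x ∂(ρ.comap ((↑) : X → E)) := by
  have hXm := hX.measurableSet
  have := isProbabilityMeasure_comap_coe hXm hρ
  have := isCompact_iff_compactSpace.1 hX
  have hemb := MeasurableEmbedding.subtype_coe hXm
  have hmap := map_comap_coe_of_measure_compl hXm hρ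
  have hcomp : Function.extend Subtype.val φ 0 ∘ ((↑) : X → E) = φ :=
    funext fun x => Subtype.val_injective.extend_apply φ 0 x
  constructor
  · rw [← hmap, hemb.integrable_map_iff, hcomp]
    exact φ.continuous.integrable_of_hasCompactSupport (HasCompactSupport.of_compactSpace φ)
  · conv_lhs => rw [← hmap]
    rw [hemb.integral_map]
    exact integral_congr_ae (Eventually.of_forall fun x => congrFun hcomp x)

end Plans

section Optimal

variable {d : ℕ} {X Y : Set (EuclideanSpace ℝ (Fin d))}
  {c : EuclideanSpace ℝ (Fin d) → EuclideanSpace ℝ (Fin d) → ℝ}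
  {ρ μ : Measure (EuclideanSpace ℝ (Fin d))} [IsProbabilityMeasure ρ] [IsProbabilityMeasure μ]
  {γ : Measure (EuclideanSpace ℝ (Fin d) × EuclideanSpace ℝ (Fin d))}

theorem IsOptimalPlan.integral_le_dual (hγ : IsOptimalPlan ρ μ c γ)
    (hX : IsCompact X) (hY : IsCompact Y)
    (hc : ContinuousOn (fun q : EuclideanSpace ℝ (Fin d) × EuclideanSpace ℝ (Fin d) =>
      c q.1 q.2) (X ×ˢ Y))
    (hρ : ρ Xᶜ = 0) (hμ : μ Yᶜ = 0) {M : ℝ}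
    (hM : ∀ φ ψ : EuclideanSpace ℝ (Fin d) → ℝ, Integrable φ ρ → Integrable ψ μ →
      (∀ x ∈ X, ∀ y ∈ Y, φ x + ψ y ≤ c x y) → ∫ x, φ x ∂ρ + ∫ y, ψ y ∂μ ≤ M) :
    ∫ q, c q.1 q.2 ∂γ ≤ M := by
  have hXm := hX.measurableSet
  have hYm := hY.measurableSet
  have := isProbabilityMeasure_comap_coe hXm hρ
  have := isProbabilityMeasure_comap_coe hYm hμ
  have := isCompact_iff_compactSpace.1 hX
  have := isCompact_iff_compactSpace.1 hY
  let c' : C(X × Y, ℝ) := ⟨fun q => c q.1 q.2,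
    hc.comp_continuous (f := fun q : X × Y => ((q.1 : EuclideanSpace ℝ (Fin d)),
      (q.2 : EuclideanSpace ℝ (Fin d)))) (by fun_prop) fun q => ⟨q.1.2, q.2.2⟩⟩
  obtain ⟨π, hfst, hsnd, hπ⟩ := exists_plan_integral_le_dual (ρ := ρ.comap ((↑) : X → _))
    (μ := μ.comap ((↑) : Y → _)) c'
  have hemb := (MeasurableEmbedding.subtype_coe hXm).prodMap (MeasurableEmbedding.subtype_coe hYm)
  have hle := hγ.2.2 (π.map (Prod.map (↑) (↑)))
    (by
      rw [Measure.fst, Measure.map_map measurable_fst hemb.measurable]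
      change π.map (Subtype.val ∘ Prod.fst) = ρ
      rw [← Measure.map_map measurable_subtype_coe measurable_fst]
      change π.fst.map _ = ρ
      rw [hfst, map_comap_coe_of_measure_compl hXm hρ])
    (by
      rw [Measure.snd, Measure.map_map measurable_snd hemb.measurable]
      change π.map (Subtype.val ∘ Prod.snd) = μ
      rw [← Measure.map_map measurable_subtype_coe measurable_snd]
      change π.snd.map _ = μ
      rw [hsnd, map_comap_coe_of_measure_compl hYm hμ])
  rw [hemb.integral_map] at hle
  refine hle.trans (hπ M fun φ ψ hφψ => ?_)
  obtain ⟨hφ, hφ_eq⟩ := integrable_extend_and_integral_eq hX hρ φ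
  obtain ⟨hψ, hψ_eq⟩ := integrable_extend_and_integral_eq hY hμ ψ
  rw [← hφ_eq, ← hψ_eq]
  refine hM _ _ hφ hψ fun x hx y hy => ?_
  have h₁ := Subtype.val_injective.extend_apply φ 0 (⟨x, hx⟩ : X)
  have h₂ := Subtype.val_injective.extend_apply ψ 0 (⟨y, hy⟩ : Y)
  rw [h₁, h₂]
  exact hφψ ⟨x, hx⟩ ⟨y, hy⟩

/-- An optimal dual pair saturates the constraint almost everywhere for any optimal plan. -/
theorem IsOptimalPlan.ae_eq_cost (hγ : IsOptimalPlan ρ μ c γ)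
    (hX : IsCompact X) (hY : IsCompact Y)
    (hc : ContinuousOn (fun q : EuclideanSpace ℝ (Fin d) × EuclideanSpace ℝ (Fin d) =>
      c q.1 q.2) (X ×ˢ Y))
    (hρ : ρ Xᶜ = 0) (hμ : μ Yᶜ = 0) {φ₀ ψ₀ : EuclideanSpace ℝ (Fin d) → ℝ}
    (hφ₀ : ContinuousOn φ₀ X) (hψ₀ : ContinuousOn ψ₀ Y)
    (hadm : ∀ x ∈ X, ∀ y ∈ Y, φ₀ x + ψ₀ y ≤ c x y)
    (hopt : ∀ φ ψ : EuclideanSpace ℝ (Fin d) → ℝ, Integrable φ ρ → Integrable ψ μ →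
      (∀ x ∈ X, ∀ y ∈ Y, φ x + ψ y ≤ c x y) →
      ∫ x, φ x ∂ρ + ∫ y, ψ y ∂μ ≤ ∫ x, φ₀ x ∂ρ + ∫ y, ψ₀ y ∂μ) :
    ∀ᵐ q ∂γ, φ₀ q.1 + ψ₀ q.2 = c q.1 q.2 := by
  have hle := hγ.integral_le_dual hX hY hc hρ hμ hopt
  obtain ⟨hfst, hsnd, -⟩ := hγ
  have hγ_prob : IsProbabilityMeasure γ := by
    constructor
    rw [← Measure.fst_univ, hfst, measure_univ]
  have hnull := measure_compl_prod_of_marginals hfst hsnd hX.measurableSet hY.measurableSet hρ hμ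
  have hφi := integrable_of_continuousOn_of_measure_compl hX hρ hφ₀
  have hψi := integrable_of_continuousOn_of_measure_compl hY hμ hψ₀
  have hci := integrable_of_continuousOn_of_measure_compl (hX.prod hY) hnull hc
  rw [← hfst, Measure.fst] at hφi hle
  rw [← hsnd, Measure.snd] at hψi hle
  rw [integral_map measurable_fst.aemeasurable hφi.aestronglyMeasurable,
    integral_map measurable_snd.aemeasurable hψi.aestronglyMeasurable] at hle
  have hφγ : Integrable (fun q => φ₀ q.1) γ := hφi.comp_measurable measurable_fst
  have hψγ : Integrable (fun q => ψ₀ q.2) γ := hψi.comp_measurable measurable_snd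
  have hsum : Integrable (fun q => φ₀ q.1 + ψ₀ q.2) γ := hφγ.add hψγ
  rw [← integral_add hφγ hψγ] at hle
  have hle_ae : (fun q => φ₀ q.1 + ψ₀ q.2) ≤ᵐ[γ] fun q => c q.1 q.2 := by
    filter_upwards [show ∀ᵐ q ∂γ, q ∈ X ×ˢ Y from hnull] with q hq
    exact hadm _ hq.1 _ hq.2
  exact (integral_eq_iff_of_ae_le hsum hci hle_ae).1
    (le_antisymm (integral_mono_ae hsum hci hle_ae) hle)

end Optimal

/-- If a plan with first marginal `ρ` is carried by a compact set, every point of the support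
of `ρ` is the first coordinate of a point of that set. -/
theorem exists_mem_of_mem_msupport_fst {E F : Type*} [TopologicalSpace E] [T2Space E]
    [MeasurableSpace E] [OpensMeasurableSpace E] [TopologicalSpace F] [MeasurableSpace F]
    {γ : Measure (E × F)} {T : Set (E × F)} (hT : IsCompact T) (hγ : γ Tᶜ = 0) {x : E}
    (hx : x ∈ msupport γ.fst) : ∃ y, (x, y) ∈ T := by
  by_contra! hxT
  have hopen : IsOpen (Prod.fst '' T)ᶜ := (hT.image continuous_fst).isClosed.isOpen_compl
  refine hx _ hopen (by simpa using hxT) ?_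
  rw [Measure.fst_apply hopen.measurableSet]
  exact measure_mono_null (fun q hq hqT => hq ⟨q, hqT, rfl⟩) hγ

theorem exists_mem_of_mem_msupport_snd {E F : Type*} [TopologicalSpace E] [MeasurableSpace E]
    [TopologicalSpace F] [T2Space F] [MeasurableSpace F] [OpensMeasurableSpace F]
    {γ : Measure (E × F)} {T : Set (E × F)} (hT : IsCompact T) (hγ : γ Tᶜ = 0) {y : F}
    (hy : y ∈ msupport γ.snd) : ∃ x, (x, y) ∈ T := by
  by_contra! hyT
  have hopen : IsOpen (Prod.snd '' T)ᶜ := (hT.image continuous_snd).isClosed.isOpen_compl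
  refine hy _ hopen (by simpa using hyT) ?_
  rw [Measure.snd_apply hopen.measurableSet]
  exact measure_mono_null (fun q hq hqT => hq ⟨q, hqT, rfl⟩) hγ

theorem SimpleGraph.Connected.eq_of_forall_adj {V α : Type*} {G : SimpleGraph V}
    (hG : G.Connected) {f : V → α} (hf : ∀ u v, G.Adj u v → f u = f v) (u v : V) :
    f u = f v := by
  obtain ⟨p⟩ := hG.preconnected u v
  induction p with
  | nil => rfl
  | cons h _ ih => exact (hf _ _ h).trans ih

/-- Graph criterion for uniqueness of continuous Kantorovich potentials: if the bipartite
graph on the Lipschitz-path connected components of the supports (edges given by optimal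
plans charging `Aᵢ × Bⱼ`) is connected, then optimal dual potentials are unique up to an
additive constant. -/
theorem potentials_unique_of_connected_component_graph {d : ℕ} {I J : Type}
    [Fintype I] [Fintype J]
    (X Y : Set (EuclideanSpace ℝ (Fin d))) (hXc : IsCompact X) (hYc : IsCompact Y)
    (c : EuclideanSpace ℝ (Fin d) → EuclideanSpace ℝ (Fin d) → ℝ)
    (hc : ContDiffOn ℝ 1 (fun q : EuclideanSpace ℝ (Fin d) × EuclideanSpace ℝ (Fin d) =>
      c q.1 q.2) (X ×ˢ Y))
    (ρ μ : Measure (EuclideanSpace ℝ (Fin d)))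
    [IsProbabilityMeasure ρ] [IsProbabilityMeasure μ]
    (hρX : msupport ρ ⊆ X) (hμY : msupport μ ⊆ Y)
    (A : I → Set (EuclideanSpace ℝ (Fin d))) (B : J → Set (EuclideanSpace ℝ (Fin d)))
    (hA : msupport ρ = ⋃ i, A i) (hB : msupport μ = ⋃ j, B j)
    (hAconn : ∀ i, LipPathConn (A i)) (hBconn : ∀ j, LipPathConn (B j))
    (hconn : (SimpleGraph.fromRel (componentRel ρ μ c A B)).Connected)
    (φ₀ ψ₀ φ₁ ψ₁ : EuclideanSpace ℝ (Fin d) → ℝ)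
    (hφ₀cont : ContinuousOn φ₀ X) (hφ₁cont : ContinuousOn φ₁ X)
    (hψ₀cont : ContinuousOn ψ₀ Y) (hψ₁cont : ContinuousOn ψ₁ Y)
    -- each pair is a conjugate (`c`-concave) pair
    (hconj₀φ : ∀ x ∈ X, φ₀ x = sInf ((fun y => c x y - ψ₀ y) '' Y))
    (hconj₀ψ : ∀ y ∈ Y, ψ₀ y = sInf ((fun x => c x y - φ₀ x) '' X))
    (hconj₁φ : ∀ x ∈ X, φ₁ x = sInf ((fun y => c x y - ψ₁ y) '' Y))
    (hconj₁ψ : ∀ y ∈ Y, ψ₁ y = sInf ((fun x => c x y - φ₁ x) '' X))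
    -- admissibility
    (hadm₀ : ∀ x ∈ X, ∀ y ∈ Y, φ₀ x + ψ₀ y ≤ c x y)
    (hadm₁ : ∀ x ∈ X, ∀ y ∈ Y, φ₁ x + ψ₁ y ≤ c x y)
    -- optimality for the dual problem
    (hopt₀ : ∀ φ ψ : EuclideanSpace ℝ (Fin d) → ℝ, Integrable φ ρ → Integrable ψ μ →
      (∀ x ∈ X, ∀ y ∈ Y, φ x + ψ y ≤ c x y) →
      ∫ x, φ x ∂ρ + ∫ y, ψ y ∂μ ≤ ∫ x, φ₀ x ∂ρ + ∫ y, ψ₀ y ∂μ)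
    (hopt₁ : ∀ φ ψ : EuclideanSpace ℝ (Fin d) → ℝ, Integrable φ ρ → Integrable ψ μ →
      (∀ x ∈ X, ∀ y ∈ Y, φ x + ψ y ≤ c x y) →
      ∫ x, φ x ∂ρ + ∫ y, ψ y ∂μ ≤ ∫ x, φ₁ x ∂ρ + ∫ y, ψ₁ y ∂μ) :
    ∃ lam : ℝ, (∀ x ∈ msupport ρ, φ₁ x = φ₀ x + lam) ∧
      (∀ y ∈ msupport μ, ψ₁ y = ψ₀ y - lam) := by
  have hρ := measure_compl_of_msupport_subset hρX
  have hμ := measure_compl_of_msupport_subset hμY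
  have hsat : ∀ γ, IsOptimalPlan ρ μ c γ → ∀ᵐ q ∂γ,
      φ₀ q.1 + ψ₀ q.2 = c q.1 q.2 ∧ φ₁ q.1 + ψ₁ q.2 = c q.1 q.2 := fun γ hγ =>
    (hγ.ae_eq_cost hXc hYc hc.continuousOn hρ hμ hφ₀cont hψ₀cont hadm₀ hopt₀).and
      (hγ.ae_eq_cost hXc hYc hc.continuousOn hρ hμ hφ₁cont hψ₁cont hadm₁ hopt₁)
  obtain ⟨x₀, hx₀⟩ : (msupport ρ).Nonempty := by
    rw [msupport_eq_support]
    exact Measure.nonempty_support (IsProbabilityMeasure.ne_zero ρ)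
  obtain ⟨y₀, hy₀⟩ : (msupport μ).Nonempty := by
    rw [msupport_eq_support]
    exact Measure.nonempty_support (IsProbabilityMeasure.ne_zero μ)
  obtain ⟨i₀, -⟩ := mem_iUnion.1 (hA ▸ hx₀)
  obtain ⟨j₀, -⟩ := mem_iUnion.1 (hB ▸ hy₀)
  obtain ⟨γ, hγ⟩ : ∃ γ, IsOptimalPlan ρ μ c γ := by
    by_contra! hno
    have hnot : ∀ u v, ¬ componentRel ρ μ c A B u v := by
      rintro (i | j) (i' | j') h
      · exact h
      · obtain ⟨γ, hγ, -⟩ := h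
        exact hno γ hγ
      · exact h
      · exact h
    have h := hconn.eq_of_forall_adj (f := (id : I ⊕ J → I ⊕ J))
      (fun u v huv => by
        rcases ((SimpleGraph.fromRel_adj _ _ _).1 huv).2 with h | h
        · exact (hnot _ _ h).elim
        · exact (hnot _ _ h).elim) (Sum.inl i₀) (Sum.inr j₀)
    simp at h
  let T : Set (EuclideanSpace ℝ (Fin d) × EuclideanSpace ℝ (Fin d)) :=
    {q ∈ X ×ˢ Y | φ₀ q.1 + ψ₀ q.2 = c q.1 q.2 ∧ φ₁ q.1 + ψ₁ q.2 = c q.1 q.2}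
  have hT : IsCompact T := by
    have hcl : ∀ φ ψ : EuclideanSpace ℝ (Fin d) → ℝ, ContinuousOn φ X → ContinuousOn ψ Y →
        IsClosed {q ∈ X ×ˢ Y | φ q.1 + ψ q.2 = c q.1 q.2} := fun φ ψ hφ hψ =>
      (hXc.prod hYc).isClosed.isClosed_eq
        ((hφ.comp continuousOn_fst fun q hq => hq.1).add
          (hψ.comp continuousOn_snd fun q hq => hq.2)) hc.continuousOn
    refine (hXc.prod hYc).of_isClosed_subset ?_ (sep_subset _ _)
    have h := (hcl φ₀ ψ₀ hφ₀cont hψ₀cont).inter (hcl φ₁ ψ₁ hφ₁cont hψ₁cont)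
    rwa [← sep_and] at h
  have hγT : γ Tᶜ = 0 := by
    have hprod := measure_compl_prod_of_marginals hγ.1 hγ.2.1 hXc.measurableSet
      hYc.measurableSet hρ hμ
    filter_upwards [hsat γ hγ, show ∀ᵐ q ∂γ, q ∈ X ×ˢ Y from hprod] with q h hq
    exact ⟨hq, h⟩
  have hAsub : ∀ i, A i ⊆ msupport ρ := fun i => hA ▸ subset_iUnion A i
  have hBsub : ∀ j, B j ⊆ msupport μ := fun j => hB ▸ subset_iUnion B j
  have ha : ∀ i, ∃ a : ℝ, ∀ x ∈ A i, φ₁ x - φ₀ x = a := fun i =>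
    exists_const_potential_sub hXc hYc hc hadm₀ hadm₁ ((hAsub i).trans hρX) (hAconn i)
      fun x hx => by
        obtain ⟨y, hy⟩ := exists_mem_of_mem_msupport_fst hT hγT (hγ.1.symm ▸ hAsub i hx)
        exact ⟨y, hy.1.2, hy.2⟩
  have hb : ∀ j, ∃ b : ℝ, ∀ y ∈ B j, ψ₁ y - ψ₀ y = b := fun j =>
    exists_const_potential_sub (c := fun y x => c x y) hYc hXc
      (hc.comp (contDiff_snd.prodMk contDiff_fst).contDiffOn fun q hq => ⟨hq.2, hq.1⟩)
      (fun y hy x hx => by linarith [hadm₀ x hx y hy])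
      (fun y hy x hx => by linarith [hadm₁ x hx y hy]) ((hBsub j).trans hμY) (hBconn j)
      fun y hy => by
        obtain ⟨x, hx⟩ := exists_mem_of_mem_msupport_snd hT hγT (hγ.2.1.symm ▸ hBsub j hy)
        exact ⟨x, hx.1.1, by linarith [hx.2.1], by linarith [hx.2.2]⟩
  choose a ha using ha
  choose b hb using hb
  have hedge : ∀ u v, componentRel ρ μ c A B u v →
      Sum.elim a (fun j => -b j) u = Sum.elim a (fun j => -b j) v := by
    rintro (i | j) (i' | j') h
    · exact h.elim
    · obtain ⟨γ', hγ', hpos⟩ := h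
      obtain ⟨q, hq, h₀, h₁⟩ : ∃ q ∈ A i ×ˢ B j',
          φ₀ q.1 + ψ₀ q.2 = c q.1 q.2 ∧ φ₁ q.1 + ψ₁ q.2 = c q.1 q.2 := by
        by_contra! hno
        refine hpos.ne' (measure_mono_null ?_ (ae_iff.1 (hsat γ' hγ')))
        exact fun q hq h => hno q hq h.1 h.2
      simp only [Sum.elim_inl, Sum.elim_inr]
      linarith [ha i q.1 hq.1, hb j' q.2 hq.2]
    · exact h.elim
    · exact h.elim
  have hall := hconn.eq_of_forall_adj (f := Sum.elim a fun j => -b j) fun u v huv =>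
    ((SimpleGraph.fromRel_adj _ _ _).1 huv).2.elim (hedge u v) fun h => (hedge v u h).symm
  refine ⟨a i₀, fun x hx => ?_, fun y hy => ?_⟩
  · obtain ⟨i, hi⟩ := mem_iUnion.1 (hA ▸ hx)
    have h := hall (Sum.inl i) (Sum.inl i₀)
    simp only [Sum.elim_inl] at h
    linarith [ha i x hi]
  · obtain ⟨j, hj⟩ := mem_iUnion.1 (hB ▸ hy)
    have h := hall (Sum.inr j) (Sum.inl i₀)
    simp only [Sum.elim_inl, Sum.elim_inr] at h
    linarith [hb j y hj]
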